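/- Assume ψ(1̄)/φ(1̄) < min{ψ(d̄)/φ(d̄), 1}, and set α := (ψ(1̄) − φ(1̄))·φ(d̄)/φ(1̄). Let x ∈ Σ be not eventually constant with lim_{n→∞} S_nχ(x) = −∞, and set ξ := π_S(x). Then Θ'(ξ) does not exist in the generalised sense if and only if there exist c > 0 and strictly increasing sequences (n_m)_{m∈ℕ} and (k_m)_{m∈ℕ} of positive integers such that, for every m, x has a strict d-block of length k_m at the n_m-th level and e^{S_{n_m}χ(x) + k_m α} ≥ c. -/

import Mathlib

open Set Filter Topology

noncomputable section

/-- The unit interval `𝒰 = [0,1]`. -/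
abbrev UI : Set ℝ := Set.Icc 0 1

/-- An expanding piecewise `C^{1+ε}` map of the unit interval, presented through its
`d` increasing full inverse branches (ordered left to right, images covering `𝒰` with
pairwise disjoint interiors), each branch being a `C^{1+ε}` diffeomorphism onto its image
whose derivative is `ε`-Hölder continuous with values in `(0,1)`. -/
structure ExpMap (d : ℕ) (ε : ℝ) : Type where
  toFun : ℝ → ℝ
  branch : Fin d → ℝ → ℝ
  branchDeriv : Fin d → ℝ → ℝ
  maps_to : Set.MapsTo toFun UI UI
  branch_maps_to : ∀ a, Set.MapsTo (branch a) UI UI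
  branch_mono : ∀ a, StrictMonoOn (branch a) UI
  right_inv : ∀ a, ∀ ξ ∈ Set.Ico (0 : ℝ) 1, toFun (branch a ξ) = ξ
  map_one : toFun 1 = 1
  branch_hasDeriv : ∀ a, ∀ ξ ∈ UI, HasDerivWithinAt (branch a) (branchDeriv a ξ) UI ξ
  branchDeriv_mem : ∀ a, ∀ ξ ∈ UI, branchDeriv a ξ ∈ Set.Ioo (0 : ℝ) 1
  branchDeriv_holder : ∀ a, ∃ C > 0, ∀ ξ ∈ UI, ∀ η ∈ UI,
      |branchDeriv a ξ - branchDeriv a η| ≤ C * |ξ - η| ^ ε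
  ordered : ∀ a b : Fin d, a < b → ∀ ξ ∈ UI, ∀ η ∈ UI, branch a ξ ≤ branch b η
  cover : UI ⊆ ⋃ a, branch a '' UI

/-- The shift map on `Σ = {1,…,d}^ℕ` (`x n` represents the letter `x_{n+1}`). -/
def shift {d : ℕ} (x : ℕ → Fin d) : ℕ → Fin d := fun n => x (n + 1)

/-- The cylinder set `[x_1 … x_n]`. -/
def cyl {d : ℕ} (x : ℕ → Fin d) (n : ℕ) : Set (ℕ → Fin d) := {y | ∀ m < n, y m = x m}

/-- Finite approximations `S_{x_1}^{-1} ∘ ⋯ ∘ S_{x_n}^{-1}(0)` to the coding map. -/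
def approx {d : ℕ} {ε : ℝ} (S : ExpMap d ε) (x : ℕ → Fin d) (n : ℕ) : ℝ :=
  (List.range n).foldr (fun m ξ => S.branch (x m) ξ) 0

/-- The coding map `π_S : Σ → 𝒰`. -/
def proj {d : ℕ} {ε : ℝ} (S : ExpMap d ε) (x : ℕ → Fin d) : ℝ := ⨆ n, approx S x n

/-- The potential `φ(x) = log (S_{x_1}^{-1})'(π_S(σ x))` associated with `S`. -/
def pot {d : ℕ} {ε : ℝ} (S : ExpMap d ε) (x : ℕ → Fin d) : ℝ :=
  Real.log (S.branchDeriv (x 0) (proj S (shift x)))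

/-- Birkhoff sums `S_n f(x) = ∑_{m=0}^{n-1} f(σ^m x)`. -/
def birk {d : ℕ} (f : (ℕ → Fin d) → ℝ) (n : ℕ) (x : ℕ → Fin d) : ℝ :=
  ∑ m ∈ Finset.range n, f (shift^[m] x)

/-- The difference quotient `D_Θ(ξ, η) = (Θ(ξ) - Θ(η))/(ξ - η)`. -/
def DQ (Θ : ℝ → ℝ) (ξ η : ℝ) : ℝ := (Θ ξ - Θ η) / (ξ - η)

/-- `Θ` is the conjugacy between `S` and `T` : an increasing homeomorphism of `𝒰`
with `T ∘ Θ = Θ ∘ S`. -/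
def IsConjugacy {d : ℕ} {ε : ℝ} (S T : ExpMap d ε) (Θ : ℝ → ℝ) : Prop :=
  StrictMonoOn Θ UI ∧ ContinuousOn Θ UI ∧ Θ '' UI = UI ∧
    ∀ ξ ∈ UI, T.toFun (Θ ξ) = Θ (S.toFun ξ)

/-- `x` has an `i`-block of length `k` at the `n`-th level:
`x_{n+1} = ⋯ = x_{n+k} = i` and `x_{n+k+1} ≠ i`. -/
def HasBlock {d : ℕ} (x : ℕ → Fin d) (i : Fin d) (k n : ℕ) : Prop :=
  (∀ m < k, x (n + m) = i) ∧ x (n + k) ≠ i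

/-- `x` is eventually constant. -/
def EvConst {d : ℕ} (x : ℕ → Fin d) : Prop := ∃ N : ℕ, ∃ i : Fin d, ∀ n ≥ N, x n = i

/-- `Θ'(ξ)` exists in the generalised sense: `lim_{η→ξ} D_Θ(ξ,η)` exists in `[0,∞]`
(with one-sided limits at the boundary points). -/
def GenDeriv (Θ : ℝ → ℝ) (ξ : ℝ) : Prop :=
  (∃ L : ℝ, Filter.Tendsto (fun η => DQ Θ ξ η) (nhdsWithin ξ (UI \ {ξ})) (nhds L)) ∨
    Filter.Tendsto (fun η => DQ Θ ξ η) (nhdsWithin ξ (UI \ {ξ})) Filter.atTop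

namespace ExpMap

variable {d : ℕ} {ε : ℝ} (S : ExpMap d ε)

theorem branch_continuousOn (a : Fin d) : ContinuousOn (S.branch a) UI :=
  fun ξ hξ => (S.branch_hasDeriv a ξ hξ).continuousWithinAt

theorem branchDeriv_continuousOn (hε : 0 < ε) (a : Fin d) :
    ContinuousOn (S.branchDeriv a) UI := by
  obtain ⟨C, hC, h⟩ := S.branchDeriv_holder a
  intro ξ hξ
  have hlim : Tendsto (fun η => C * |η - ξ| ^ ε) (𝓝[UI] ξ) (𝓝 0) := by
    have hc : Continuous fun η : ℝ => C * |η - ξ| ^ ε := by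
      refine continuous_const.mul (Continuous.rpow_const (by fun_prop) fun _ => Or.inr hε.le)
    have := (hc.tendsto ξ).mono_left (nhdsWithin_le_nhds (s := UI))
    simpa [Real.zero_rpow hε.ne'] using this
  refine tendsto_iff_dist_tendsto_zero.2 (squeeze_zero' (Eventually.of_forall fun _ => dist_nonneg)
    ?_ hlim)
  filter_upwards [self_mem_nhdsWithin] with η hη
  exact h η hη ξ hξ

theorem exists_branchDeriv_bounds (hε : 0 < ε) (hd : 0 < d) :
    ∃ m r : ℝ, 0 < m ∧ 0 < r ∧ r < 1 ∧
      ∀ a, ∀ ξ ∈ UI, m ≤ S.branchDeriv a ξ ∧ S.branchDeriv a ξ ≤ r := by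
  have : Nonempty (Fin d) := ⟨⟨0, hd⟩⟩
  have hne : (UI : Set ℝ).Nonempty := ⟨0, by simp⟩
  have hmin := fun a => isCompact_Icc.exists_isMinOn hne (S.branchDeriv_continuousOn hε a)
  have hmax := fun a => isCompact_Icc.exists_isMaxOn hne (S.branchDeriv_continuousOn hε a)
  choose p hp hp' using hmin
  choose q hq hq' using hmax
  obtain ⟨a₀, ha₀⟩ := Finite.exists_min fun a => S.branchDeriv a (p a)
  obtain ⟨a₁, ha₁⟩ := Finite.exists_max fun a => S.branchDeriv a (q a)
  refine ⟨_, _, (S.branchDeriv_mem a₀ _ (hp a₀)).1, (S.branchDeriv_mem a₁ _ (hq a₁)).1,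
    (S.branchDeriv_mem a₁ _ (hq a₁)).2, fun a ξ hξ => ⟨(ha₀ a).trans (hp' a hξ),
      le_trans (hq' a hξ) (ha₁ a)⟩⟩

theorem exists_branch_sub_eq (a : Fin d) {u v : ℝ} (hu : u ∈ UI) (hv : v ∈ UI) :
    ∃ ζ ∈ uIcc u v, |S.branch a u - S.branch a v| = S.branchDeriv a ζ * |u - v| := by
  wlog huv : u ≤ v generalizing u v
  · obtain ⟨ζ, hζ, h⟩ := this hv hu (le_of_not_ge huv)
    exact ⟨ζ, by rwa [uIcc_comm], by rw [abs_sub_comm, h, abs_sub_comm]⟩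
  rcases huv.eq_or_lt with rfl | huv
  · exact ⟨u, by simp, by simp⟩
  have hsub : Icc u v ⊆ UI := Icc_subset_Icc hu.1 hv.2
  obtain ⟨ζ, hζ, h⟩ := exists_hasDerivAt_eq_slope (S.branch a) (S.branchDeriv a) huv
    ((S.branch_continuousOn a).mono hsub) fun t ht =>
      (S.branch_hasDeriv a t (hsub (Ioo_subset_Icc_self ht))).hasDerivAt
        (Icc_mem_nhds (hu.1.trans_lt ht.1) (ht.2.trans_le hv.2))
  refine ⟨ζ, by rw [uIcc_of_le huv.le]; exact Ioo_subset_Icc_self hζ, ?_⟩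
  have h' := S.branch_mono a hu hv huv
  rw [h, abs_of_neg (sub_neg.2 h'), abs_of_neg (sub_neg.2 huv)]
  field_simp [(sub_pos.2 huv).ne']
  ring

theorem branch_sub_bounds {m r : ℝ}
    (hb : ∀ a, ∀ ξ ∈ UI, m ≤ S.branchDeriv a ξ ∧ S.branchDeriv a ξ ≤ r)
    (a : Fin d) {u v : ℝ} (hu : u ∈ UI) (hv : v ∈ UI) :
    m * |u - v| ≤ |S.branch a u - S.branch a v| ∧
      |S.branch a u - S.branch a v| ≤ r * |u - v| := by
  obtain ⟨ζ, hζ, h⟩ := S.exists_branch_sub_eq a hu hv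
  have := hb a ζ (ordConnected_Icc.uIcc_subset hu hv hζ)
  rw [h]
  exact ⟨by gcongr; exact this.1, by gcongr; exact this.2⟩

/-- The inverse branch `S_{x_1}^{-1} ∘ ⋯ ∘ S_{x_n}^{-1}` of the `n`-th iterate. -/
def word : (ℕ → Fin d) → ℕ → ℝ → ℝ
  | _, 0 => id
  | x, n + 1 => fun u => S.branch (x 0) (word (shift x) n u)

@[simp] theorem word_zero (x : ℕ → Fin d) (u : ℝ) : S.word x 0 u = u := rfl

theorem word_succ (x : ℕ → Fin d) (n : ℕ) (u : ℝ) :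
    S.word x (n + 1) u = S.branch (x 0) (S.word (shift x) n u) := rfl

theorem word_succ' (x : ℕ → Fin d) (n : ℕ) (u : ℝ) :
    S.word x (n + 1) u = S.word x n (S.branch (x n) u) := by
  induction n generalizing x with
  | zero => rfl
  | succ n ih => rw [word_succ, ih, word_succ]; rfl

theorem word_congr {x y : ℕ → Fin d} {n : ℕ} (h : ∀ m < n, x m = y m) (u : ℝ) :
    S.word x n u = S.word y n u := by
  induction n generalizing x y with
  | zero => rfl
  | succ n ih =>
    rw [word_succ, word_succ, h 0 n.succ_pos,
      ih (x := shift x) (y := shift y) fun m hm => h (m + 1) (by omega)]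

theorem word_mem (x : ℕ → Fin d) (n : ℕ) {u : ℝ} (hu : u ∈ UI) : S.word x n u ∈ UI := by
  induction n generalizing x with
  | zero => exact hu
  | succ n ih => exact S.branch_maps_to _ (ih _)

theorem word_strictMonoOn (x : ℕ → Fin d) (n : ℕ) : StrictMonoOn (S.word x n) UI := by
  induction n generalizing x with
  | zero => exact strictMono_id.strictMonoOn _
  | succ n ih =>
    exact fun u hu v hv huv => S.branch_mono _ (S.word_mem _ _ hu) (S.word_mem _ _ hv)
      (ih _ hu hv huv)

theorem word_continuousOn (x : ℕ → Fin d) (n : ℕ) : ContinuousOn (S.word x n) UI := by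
  induction n generalizing x with
  | zero => exact continuousOn_id
  | succ n ih => exact (S.branch_continuousOn _).comp (ih _) fun u hu => S.word_mem _ _ hu

theorem abs_word_sub_le {r : ℝ} (hr : 0 ≤ r) (hb : ∀ a, ∀ ξ ∈ UI, S.branchDeriv a ξ ≤ r)
    (x : ℕ → Fin d) (n : ℕ) {u v : ℝ} (hu : u ∈ UI) (hv : v ∈ UI) :
    |S.word x n u - S.word x n v| ≤ r ^ n := by
  induction n generalizing x with
  | zero =>
    rw [word_zero, word_zero, pow_zero, abs_le]
    constructor <;> linarith [hu.1, hu.2, hv.1, hv.2]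
  | succ n ih =>
    rw [word_succ, word_succ, pow_succ']
    refine (S.branch_sub_bounds (m := 0) (r := r)
      (fun a ξ hξ => ⟨(S.branchDeriv_mem a ξ hξ).1.le, hb a ξ hξ⟩)
      (x 0) (S.word_mem _ _ hu) (S.word_mem _ _ hv)).2.trans ?_
    gcongr
    exact ih _

theorem approx_eq_word (x : ℕ → Fin d) (n : ℕ) : approx S x n = S.word x n 0 := by
  have (u : ℝ) : (List.range n).foldr (fun m ξ => S.branch (x m) ξ) u = S.word x n u := by
    induction n generalizing u with
    | zero => rfl
    | succ n ih => rw [List.range_succ, List.foldr_append, word_succ']; exact ih _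
  exact this 0

theorem approx_mem (x : ℕ → Fin d) (n : ℕ) : approx S x n ∈ UI := by
  rw [approx_eq_word]; exact S.word_mem _ _ (by simp)

theorem approx_monotone (x : ℕ → Fin d) : Monotone (approx S x) := by
  refine monotone_nat_of_le_succ fun n => ?_
  rw [approx_eq_word, approx_eq_word, word_succ']
  exact (S.word_strictMonoOn x n).monotoneOn (by simp) (S.branch_maps_to _ (by simp))
    (S.branch_maps_to (x n) (show (0 : ℝ) ∈ UI by simp)).1

theorem tendsto_approx (x : ℕ → Fin d) : Tendsto (approx S x) atTop (𝓝 (proj S x)) :=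
  tendsto_atTop_ciSup (S.approx_monotone x)
    ⟨1, by rintro _ ⟨n, rfl⟩; exact (S.approx_mem x n).2⟩

theorem proj_mem (x : ℕ → Fin d) : proj S x ∈ UI :=
  isClosed_Icc.mem_of_tendsto (S.tendsto_approx x) (Eventually.of_forall (S.approx_mem x))

theorem proj_eq_branch (x : ℕ → Fin d) : proj S x = S.branch (x 0) (proj S (shift x)) := by
  have h₁ := (tendsto_add_atTop_iff_nat 1).2 (S.tendsto_approx x)
  have h₂ : Tendsto (fun n => S.branch (x 0) (approx S (shift x) n)) atTop
      (𝓝 (S.branch (x 0) (proj S (shift x)))) :=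
    ((S.branch_continuousOn (x 0)) _ (S.proj_mem _)).tendsto.comp
      (tendsto_nhdsWithin_iff.2 ⟨S.tendsto_approx _, Eventually.of_forall (S.approx_mem _)⟩)
  refine tendsto_nhds_unique h₁ (h₂.congr fun n => ?_)
  rw [approx_eq_word, approx_eq_word, word_succ]

theorem proj_eq_word (x : ℕ → Fin d) (n : ℕ) :
    proj S x = S.word x n (proj S (shift^[n] x)) := by
  induction n generalizing x with
  | zero => rfl
  | succ n ih => rw [proj_eq_branch, ih, word_succ, Function.iterate_succ_apply]

/-- A coherent choice of points in the nested cylinders of `x` starts at the coded point. -/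
theorem proj_unique (hε : 0 < ε) (hd : 0 < d) (x : ℕ → Fin d) (z : ℕ → ℝ) (hz : ∀ n, z n ∈ UI)
    (h : ∀ n, z n = S.branch (x n) (z (n + 1))) : proj S x = z 0 := by
  obtain ⟨m, r, hm, hr, hr1, hb⟩ := S.exists_branchDeriv_bounds hε hd
  have hw : ∀ n, z 0 = S.word x n (z n) := by
    intro n
    induction n with
    | zero => rfl
    | succ n ih => rw [ih, word_succ', ← h]
  refine tendsto_nhds_unique (S.tendsto_approx x) (tendsto_iff_dist_tendsto_zero.2
    (squeeze_zero (fun _ => dist_nonneg) (fun n => ?_)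
      (tendsto_pow_atTop_nhds_zero_of_lt_one hr.le hr1)))
  rw [Real.dist_eq, approx_eq_word, hw n]
  exact S.abs_word_sub_le hr.le (fun a ξ hξ => (hb a ξ hξ).2) x n (by simp) (hz n)

theorem proj_const (hε : 0 < ε) {i : Fin d} {e : ℝ} (he : e ∈ UI) (h : S.branch i e = e) :
    proj S (fun _ => i) = e :=
  S.proj_unique hε i.pos (fun _ => i) (fun _ => e) (fun _ => he) fun _ => h.symm

theorem birk_succ' (f : (ℕ → Fin d) → ℝ) (n : ℕ) (x : ℕ → Fin d) :
    birk f (n + 1) x = f x + birk f n (shift x) := by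
  simp [birk, Finset.sum_range_succ', add_comm]

theorem birk_add (f : (ℕ → Fin d) → ℝ) (n k : ℕ) (x : ℕ → Fin d) :
    birk f (n + k) x = birk f n x + birk f k (shift^[n] x) := by
  simp only [birk, Finset.sum_range_add, ← Function.iterate_add_apply]
  congr 1
  exact Finset.sum_congr rfl fun m _ => by rw [add_comm]

theorem pot_neg (x : ℕ → Fin d) : pot S x < 0 :=
  Real.log_neg (S.branchDeriv_mem _ _ (S.proj_mem _)).1 (S.branchDeriv_mem _ _ (S.proj_mem _)).2

theorem exists_log_branchDeriv_holder (hε : 0 < ε) (hd : 0 < d) :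
    ∃ C > 0, ∀ a, ∀ ξ ∈ UI, ∀ η ∈ UI,
      |Real.log (S.branchDeriv a ξ) - Real.log (S.branchDeriv a η)| ≤ C * |ξ - η| ^ ε := by
  obtain ⟨m, r, hm, hr, hr1, hb⟩ := S.exists_branchDeriv_bounds hε hd
  have : Nonempty (Fin d) := ⟨⟨0, hd⟩⟩
  choose C hC hC' using S.branchDeriv_holder
  obtain ⟨a₁, ha₁⟩ := Finite.exists_max C
  have key : ∀ s t : ℝ, m ≤ s → m ≤ t → Real.log s - Real.log t ≤ m⁻¹ * |s - t| := by
    intro s t hs ht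
    have ht0 := hm.trans_le ht
    have hs0 := hm.trans_le hs
    rw [← Real.log_div hs0.ne' ht0.ne']
    calc Real.log (s / t) ≤ s / t - 1 := Real.log_le_sub_one_of_pos (div_pos hs0 ht0)
      _ = t⁻¹ * (s - t) := by field_simp
      _ ≤ t⁻¹ * |s - t| := by gcongr; exact le_abs_self _
      _ ≤ m⁻¹ * |s - t| := by gcongr
  refine ⟨m⁻¹ * C a₁, mul_pos (inv_pos.2 hm) (hC a₁), fun a ξ hξ η hη => ?_⟩
  have h : |Real.log (S.branchDeriv a ξ) - Real.log (S.branchDeriv a η)| ≤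
      m⁻¹ * |S.branchDeriv a ξ - S.branchDeriv a η| := by
    rw [abs_sub_le_iff]
    refine ⟨key _ _ (hb a ξ hξ).1 (hb a η hη).1, ?_⟩
    rw [abs_sub_comm]
    exact key _ _ (hb a η hη).1 (hb a ξ hξ).1
  refine h.trans ?_
  rw [mul_assoc]
  gcongr
  refine (hC' a ξ hξ η hη).trans ?_
  gcongr
  exact ha₁ a

/-- Bounded distortion. -/
theorem exists_distortion (hε : 0 < ε) (hd : 0 < d) :
    ∃ K > 0, ∀ x n, ∀ u ∈ UI, ∀ v ∈ UI,
      K⁻¹ * Real.exp (birk (pot S) n x) * |u - v| ≤ |S.word x n u - S.word x n v| ∧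
      |S.word x n u - S.word x n v| ≤ K * Real.exp (birk (pot S) n x) * |u - v| := by
  obtain ⟨m, r, hm, hr, hr1, hb⟩ := S.exists_branchDeriv_bounds hε hd
  obtain ⟨C, hC, hlog⟩ := S.exists_log_branchDeriv_holder hε hd
  set q := r ^ ε with hq
  have hq0 : 0 < q := Real.rpow_pos_of_pos hr _
  have hq1 : q < 1 := Real.rpow_lt_one hr.le hr1 hε
  have key : ∀ n x, ∀ u ∈ UI, ∀ v ∈ UI,
      Real.exp (birk (pot S) n x - C * ∑ j ∈ Finset.range n, q ^ j) * |u - v| ≤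
        |S.word x n u - S.word x n v| ∧
      |S.word x n u - S.word x n v| ≤
        Real.exp (birk (pot S) n x + C * ∑ j ∈ Finset.range n, q ^ j) * |u - v| := by
    intro n
    induction n with
    | zero => intro x u _ v _; simp [birk]
    | succ n ih =>
      intro x u hu v hv
      obtain ⟨ih₁, ih₂⟩ := ih (shift x) u hu v hv
      have hu' := S.word_mem (shift x) n hu
      have hv' := S.word_mem (shift x) n hv
      obtain ⟨ζ, hζ, h⟩ := S.exists_branch_sub_eq (x 0) hu' hv'
      have hζU : ζ ∈ UI := ordConnected_Icc.uIcc_subset hu' hv' hζ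
      have hdist : |ζ - proj S (shift x)| ≤ r ^ n := by
        have hs := fun w (hw : w ∈ UI) => S.abs_word_sub_le hr.le (fun a ξ hξ => (hb a ξ hξ).2)
          (shift x) n hw (S.proj_mem (shift^[n] (shift x)))
        rw [S.proj_eq_word (shift x) n]
        have h₁ := abs_le.1 (hs u hu)
        have h₂ := abs_le.1 (hs v hv)
        rw [mem_uIcc] at hζ
        rw [abs_le]
        rcases hζ with hζ | hζ <;> constructor <;> linarith [hζ.1, hζ.2]
      have hD := (S.branchDeriv_mem (x 0) ζ hζU).1
      have hl : |Real.log (S.branchDeriv (x 0) ζ) - pot S x| ≤ C * q ^ n := by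
        refine (hlog (x 0) ζ hζU _ (S.proj_mem _)).trans ?_
        gcongr
        rw [hq, ← Real.rpow_natCast, ← Real.rpow_mul hr.le, mul_comm, Real.rpow_mul hr.le,
          Real.rpow_natCast]
        exact Real.rpow_le_rpow (abs_nonneg _) hdist hε.le
      obtain ⟨hl₁, hl₂⟩ := abs_le.1 hl
      rw [word_succ, word_succ, h, birk_succ', Finset.sum_range_succ, ← Real.exp_log hD]
      constructor
      · calc _ = Real.exp (pot S x - C * q ^ n) * (Real.exp (birk (pot S) n (shift x) -
              C * ∑ j ∈ Finset.range n, q ^ j) * |u - v|) := by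
              rw [← mul_assoc, ← Real.exp_add]; ring_nf
          _ ≤ _ := by gcongr; linarith
      · calc _ ≤ Real.exp (pot S x + C * q ^ n) * (Real.exp (birk (pot S) n (shift x) +
              C * ∑ j ∈ Finset.range n, q ^ j) * |u - v|) := by gcongr; linarith
          _ = _ := by rw [← mul_assoc, ← Real.exp_add]; ring_nf
  have hsum : ∀ n, ∑ j ∈ Finset.range n, q ^ j ≤ (1 - q)⁻¹ := fun n => by
    rw [← tsum_geometric_of_lt_one hq0.le hq1]
    exact (summable_geometric_of_lt_one hq0.le hq1).sum_le_tsum _ fun _ _ => by positivity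
  refine ⟨Real.exp (C * (1 - q)⁻¹), Real.exp_pos _, fun x n u hu v hv => ?_⟩
  obtain ⟨h₁, h₂⟩ := key n x u hu v hv
  have := mul_le_mul_of_nonneg_left (hsum n) hC.le
  rw [← Real.exp_neg, ← Real.exp_add, ← Real.exp_add]
  exact ⟨(mul_le_mul_of_nonneg_right (Real.exp_le_exp.2 (by linarith)) (abs_nonneg _)).trans h₁,
    h₂.trans (mul_le_mul_of_nonneg_right (Real.exp_le_exp.2 (by linarith)) (abs_nonneg _))⟩

theorem exists_next {a b : Fin d} (h : a < b) : ∃ c, a < c ∧ ∀ c', a < c' → c ≤ c' :=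
  ⟨⟨a + 1, by omega⟩, by simp [Fin.lt_def], fun c' hc => by
    rw [Fin.lt_def] at hc; rw [Fin.le_def]; exact hc⟩

theorem branch_le_branch {a b : Fin d} (hab : a ≤ b) {u v : ℝ} (hu : u ∈ UI) (hv : v ∈ UI)
    (huv : u ≤ v) : S.branch a u ≤ S.branch b v := by
  rcases hab.eq_or_lt with rfl | h
  · exact (S.branch_mono a).monotoneOn hu hv huv
  · exact S.ordered a b h u hu v hv

theorem exists_eq_branch {p : ℝ} (hp : p ∈ UI) : ∃ a, ∃ w ∈ UI, S.branch a w = p := by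
  simpa using S.cover hp

theorem branch_bot_zero {i : Fin d} (hi : ∀ b, i ≤ b) : S.branch i 0 = 0 := by
  obtain ⟨a, w, hw, h⟩ := S.exists_eq_branch (p := 0) (by simp)
  refine le_antisymm ?_ (S.branch_maps_to i (by simp)).1
  exact (S.branch_le_branch (hi a) (by simp) hw hw.1).trans h.le

theorem branch_top_one {i : Fin d} (hi : ∀ b, b ≤ i) : S.branch i 1 = 1 := by
  obtain ⟨a, w, hw, h⟩ := S.exists_eq_branch (p := 1) (by simp)
  refine le_antisymm (S.branch_maps_to i (by simp)).2 ?_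
  exact h.ge.trans (S.branch_le_branch (hi a) hw (by simp) hw.2)

theorem branch_one_eq_branch_zero {a b : Fin d} (hab : a < b) (hb : ∀ c, a < c → b ≤ c) :
    S.branch a 1 = S.branch b 0 := by
  have h0 : (0 : ℝ) ∈ UI := by simp
  have h1 : (1 : ℝ) ∈ UI := by simp
  refine le_antisymm (S.ordered a b hab 1 h1 0 h0) ?_
  by_contra! hlt
  obtain ⟨p, hp₁, hp₂⟩ := exists_between hlt
  obtain ⟨c, w, hw, rfl⟩ := S.exists_eq_branch (p := p)
    ⟨(S.branch_maps_to a h1).1.trans hp₁.le, hp₂.le.trans (S.branch_maps_to b h0).2⟩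
  rcases le_or_gt c a with hc | hc
  · exact hp₁.not_ge (S.branch_le_branch hc hw h1 hw.2)
  · exact hp₂.not_ge (S.branch_le_branch (hb c hc) h0 hw hw.1)

theorem exists_eq_branch_Ico {p : ℝ} (hp : p ∈ Ico (0 : ℝ) 1) :
    ∃ a, ∃ w ∈ Ico (0 : ℝ) 1, S.branch a w = p := by
  obtain ⟨a, w, hw, h⟩ := S.exists_eq_branch (Ico_subset_Icc_self hp)
  rcases hw.2.lt_or_eq with h1 | rfl
  · exact ⟨a, w, ⟨hw.1, h1⟩, h⟩
  by_cases ht : ∀ b, b ≤ a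
  · rw [S.branch_top_one ht] at h
    exact absurd h hp.2.ne'
  · push Not at ht
    obtain ⟨b, hb⟩ := ht
    obtain ⟨c, hac, hc⟩ := exists_next hb
    exact ⟨c, 0, by simp, by rw [← h, S.branch_one_eq_branch_zero hac hc]⟩

end ExpMap

namespace IsConjugacy

variable {d : ℕ} {ε : ℝ} {S T : ExpMap d ε} {Θ : ℝ → ℝ}

theorem mem (hΘ : IsConjugacy S T Θ) {u : ℝ} (hu : u ∈ UI) : Θ u ∈ UI :=
  hΘ.2.2.1 ▸ mem_image_of_mem Θ hu

theorem map_zero (hΘ : IsConjugacy S T Θ) : Θ 0 = 0 := by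
  obtain ⟨u, hu, h⟩ : (0 : ℝ) ∈ Θ '' UI := by rw [hΘ.2.2.1]; simp
  refine le_antisymm ?_ (hΘ.mem (by simp)).1
  exact (hΘ.1.monotoneOn (by simp) hu hu.1).trans h.le

theorem map_one (hΘ : IsConjugacy S T Θ) : Θ 1 = 1 := by
  obtain ⟨u, hu, h⟩ : (1 : ℝ) ∈ Θ '' UI := by rw [hΘ.2.2.1]; simp
  refine le_antisymm (hΘ.mem (by simp)).2 ?_
  exact h.ge.trans (hΘ.1.monotoneOn hu (by simp) hu.2)

theorem map_branch_zero (hΘ : IsConjugacy S T Θ) (a : Fin d) :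
    Θ (S.branch a 0) = T.branch a 0 := by
  have h0 : (0 : ℝ) ∈ UI := by simp
  have h1 : (1 : ℝ) ∈ UI := by simp
  have key : ∀ a, ∃ b, Θ (S.branch a 0) = T.branch b 0 := by
    intro a
    have hlt : S.branch a 0 < 1 :=
      (S.branch_mono a h0 h1 one_pos).trans_le (S.branch_maps_to a h1).2
    have hmem := S.branch_maps_to a h0
    obtain ⟨b, w, hw, h⟩ := T.exists_eq_branch_Ico (p := Θ (S.branch a 0))
      ⟨(hΘ.mem hmem).1, by rw [← hΘ.map_one]; exact hΘ.1 hmem h1 hlt⟩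
    have := hΘ.2.2.2 _ hmem
    rw [← h, T.right_inv b w hw, S.right_inv a 0 (by simp), hΘ.map_zero] at this
    exact ⟨b, by rw [← h, this]⟩
  choose f hf using key
  have hmono : StrictMono f := by
    intro a b hab
    by_contra! hle
    have h₁ : S.branch a 0 < S.branch b 0 :=
      (S.branch_mono a h0 h1 one_pos).trans_le (S.ordered a b hab 1 h1 0 h0)
    have h₂ := hΘ.1 (S.branch_maps_to a h0) (S.branch_maps_to b h0) h₁
    rw [hf, hf] at h₂
    exact h₂.not_ge (T.branch_le_branch hle h0 h0 le_rfl)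
  have hid : f = id := (hmono.range_inj strictMono_id).1 (by
    rw [(Finite.injective_iff_surjective.1 hmono.injective).range_eq, range_id])
  rw [hf, hid, id]

theorem map_branch (hΘ : IsConjugacy S T Θ) (a : Fin d) {u : ℝ} (hu : u ∈ UI) :
    Θ (S.branch a u) = T.branch a (Θ u) := by
  have h0 : (0 : ℝ) ∈ UI := by simp
  have h1 : (1 : ℝ) ∈ UI := by simp
  rcases hu.2.lt_or_eq with hu1 | rfl
  · have hmem := S.branch_maps_to a hu
    have hlt : S.branch a u < S.branch a 1 := S.branch_mono a hu h1 hu1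
    have hΘlt := hΘ.1 hmem (S.branch_maps_to a h1) hlt
    obtain ⟨c, w, hw, h⟩ := T.exists_eq_branch_Ico (p := Θ (S.branch a u))
      ⟨(hΘ.mem hmem).1, hΘlt.trans_le (hΘ.mem (S.branch_maps_to a h1)).2⟩
    have hw' := Ico_subset_Icc_self hw
    have hwΘ := hΘ.2.2.2 _ hmem
    rw [← h, T.right_inv c w hw, S.right_inv a u ⟨hu.1, hu1⟩] at hwΘ
    rw [← h, hwΘ]
    congr 1
    rcases lt_trichotomy c a with hc | hc | hc
    · have h₁ := hΘ.1.monotoneOn (S.branch_maps_to a h0) hmem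
        ((S.branch_mono a).monotoneOn h0 hu hu.1)
      rw [hΘ.map_branch_zero, ← h] at h₁
      exact absurd ((T.branch_mono c hw' h1 hw.2).trans_le (T.ordered c a hc 1 h1 0 h0)) h₁.not_gt
    · exact hc
    · have h₁ := hΘ.1.monotoneOn (S.branch_maps_to a h1) (S.branch_maps_to c h0)
        (S.ordered a c hc 1 h1 0 h0)
      rw [hΘ.map_branch_zero] at h₁
      rw [← h] at hΘlt
      exact absurd ((T.branch_mono c).monotoneOn h0 hw' hw.1) (hΘlt.trans_le h₁).not_ge
  · rw [hΘ.map_one]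
    by_cases ht : ∀ b, b ≤ a
    · rw [S.branch_top_one ht, T.branch_top_one ht, hΘ.map_one]
    · push Not at ht
      obtain ⟨b, hb⟩ := ht
      obtain ⟨c, hac, hc⟩ := ExpMap.exists_next hb
      rw [S.branch_one_eq_branch_zero hac hc, T.branch_one_eq_branch_zero hac hc,
        hΘ.map_branch_zero]

theorem map_word (hΘ : IsConjugacy S T Θ) (x : ℕ → Fin d) (n : ℕ) {u : ℝ} (hu : u ∈ UI) :
    Θ (S.word x n u) = T.word x n (Θ u) := by
  induction n generalizing x with
  | zero => rfl
  | succ n ih => rw [ExpMap.word_succ, hΘ.map_branch _ (S.word_mem _ _ hu), ih]; rfl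

theorem monotone (hΘ : IsConjugacy S T Θ) {u v : ℝ} (hu : u ∈ UI) (hv : v ∈ UI) (h : u ≤ v) :
    Θ u ≤ Θ v := hΘ.1.monotoneOn hu hv h

theorem DQ_eq_abs (hΘ : IsConjugacy S T Θ) {u v : ℝ} (hu : u ∈ UI) (hv : v ∈ UI) :
    DQ Θ u v = |Θ u - Θ v| / |u - v| := by
  rcases le_total u v with h | h
  · rw [DQ, abs_of_nonpos (sub_nonpos.2 h), abs_of_nonpos (sub_nonpos.2 (hΘ.monotone hu hv h)),
      neg_div_neg_eq]
  · rw [DQ, abs_of_nonneg (sub_nonneg.2 h), abs_of_nonneg (sub_nonneg.2 (hΘ.monotone hv hu h))]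

theorem DQ_nonneg (hΘ : IsConjugacy S T Θ) {u v : ℝ} (hu : u ∈ UI) (hv : v ∈ UI) :
    0 ≤ DQ Θ u v := by rw [hΘ.DQ_eq_abs hu hv]; positivity

theorem birk_sub (n : ℕ) (x : ℕ → Fin d) :
    birk (fun z => pot T z - pot S z) n x = birk (pot T) n x - birk (pot S) n x := by
  simp [birk, Finset.sum_sub_distrib]

/-- Bounded distortion for difference quotients of the conjugacy. -/
theorem exists_DQ_distortion (hΘ : IsConjugacy S T Θ) (hε : 0 < ε) (hd : 0 < d) :
    ∃ K > 0, ∀ x n, ∀ u ∈ UI, ∀ v ∈ UI, u ≠ v →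
      K⁻¹ * Real.exp (birk (fun z => pot T z - pot S z) n x) * DQ Θ u v ≤
        DQ Θ (S.word x n u) (S.word x n v) ∧
      DQ Θ (S.word x n u) (S.word x n v) ≤
        K * Real.exp (birk (fun z => pot T z - pot S z) n x) * DQ Θ u v := by
  obtain ⟨K, hK, hS⟩ := S.exists_distortion hε hd
  obtain ⟨K', hK', hT⟩ := T.exists_distortion hε hd
  refine ⟨K' * K, by positivity, fun x n u hu v hv huv => ?_⟩
  obtain ⟨hS₁, hS₂⟩ := hS x n u hu v hv
  obtain ⟨hT₁, hT₂⟩ := hT x n (Θ u) (hΘ.mem hu) (Θ v) (hΘ.mem hv)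
  have huv' : 0 < |u - v| := abs_pos.2 (sub_ne_zero.2 huv)
  have hpos : 0 < |S.word x n u - S.word x n v| := lt_of_lt_of_le (by positivity) hS₁
  rw [hΘ.DQ_eq_abs hu hv, hΘ.DQ_eq_abs (S.word_mem _ _ hu) (S.word_mem _ _ hv),
    hΘ.map_word _ _ hu, hΘ.map_word _ _ hv, birk_sub, Real.exp_sub]
  constructor
  · rw [le_div_iff₀ hpos]
    refine le_trans (mul_le_mul_of_nonneg_left hS₂ (by positivity)) (le_trans (le_of_eq ?_) hT₁)
    field_simp
  · rw [div_le_iff₀ hpos]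
    refine hT₂.trans (le_trans (le_of_eq ?_) (mul_le_mul_of_nonneg_left hS₁ (by positivity)))
    field_simp

end IsConjugacy

namespace ExpMap

variable {d : ℕ} {ε : ℝ} (S : ExpMap d ε)

theorem mem_branch_image {a : Fin d} {v : ℝ} (h : v ∈ Icc (S.branch a 0) (S.branch a 1)) :
    v ∈ S.branch a '' UI :=
  intermediate_value_Icc zero_le_one (S.branch_continuousOn a) h

/-- Every point other than the coded point leaves the nested cylinders of `x` at some level. -/
theorem exists_exit (hε : 0 < ε) (hd : 0 < d) (x : ℕ → Fin d) {η : ℝ} (hη : η ∈ UI)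
    (hne : η ≠ proj S x) : ∃ n, ∃ v ∈ UI, v ∉ S.branch (x n) '' UI ∧ S.word x n v = η ∧
      ∀ N, η ∈ S.word x N '' UI → N ≤ n := by
  classical
  obtain ⟨m, r, hm, hr, hr1, hb⟩ := S.exists_branchDeriv_bounds hε hd
  have hex : ∃ n, η ∉ S.word x n '' UI := by
    by_contra! hall
    refine hne (sub_eq_zero.1 (abs_nonpos_iff.1 (ge_of_tendsto'
      (tendsto_pow_atTop_nhds_zero_of_lt_one hr.le hr1) fun n => ?_)))
    obtain ⟨v, hv, rfl⟩ := hall n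
    nth_rw 1 [S.proj_eq_word x n]
    exact S.abs_word_sub_le hr.le (fun a ξ hξ => (hb a ξ hξ).2) x n hv (S.proj_mem _)
  obtain ⟨n, hn⟩ : ∃ n, Nat.find hex = n + 1 :=
    Nat.exists_eq_succ_of_ne_zero fun h0 => by
      have := Nat.find_spec hex
      rw [h0] at this
      exact this ⟨η, hη, rfl⟩
  obtain ⟨v, hv, hvη⟩ := not_not.1 (Nat.find_min hex (m := n) (by omega))
  have hspec : η ∉ S.word x (n + 1) '' UI := hn ▸ Nat.find_spec hex
  refine ⟨n, v, hv, ?_, hvη, fun N hN => ?_⟩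
  · rintro ⟨w, hw, rfl⟩
    exact hspec ⟨w, hw, by rw [word_succ', hvη]⟩
  · by_contra! hlt
    have key : ∀ j, S.word x (n + 1 + j) '' UI ⊆ S.word x (n + 1) '' UI := by
      intro j
      induction j with
      | zero => exact subset_rfl
      | succ j ih =>
        refine subset_trans ?_ ih
        rintro _ ⟨w, hw, rfl⟩
        exact ⟨_, S.branch_maps_to _ hw, (S.word_succ' x _ w).symm⟩
    obtain ⟨j, rfl⟩ := Nat.exists_eq_add_of_le (Nat.succ_le_of_lt hlt)
    exact hspec (key j hN)

/-- `e` is the fixed point of the `i`-th branch and is at positive distance from the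
images of all other branches. -/
structure IsEndpoint (i : Fin d) (e : ℝ) : Prop where
  mem : e ∈ UI
  fix : S.branch i e = e
  sep : ∃ m > 0, ∀ b, b ≠ i → ∀ w ∈ UI, m ≤ |S.branch b w - e|

theorem isEndpoint_zero {i : Fin d} (hi : ∀ b, i ≤ b) : S.IsEndpoint i 0 where
  mem := by simp
  fix := S.branch_bot_zero hi
  sep := by
    have h1 : (1 : ℝ) ∈ UI := by simp
    refine ⟨S.branch i 1, ?_, fun b hb w hw => ?_⟩
    · have := S.branch_mono i (by simp) h1 one_pos
      rwa [S.branch_bot_zero hi] at this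
    · rw [sub_zero, abs_of_nonneg (S.branch_maps_to b hw).1]
      exact S.ordered i b (lt_of_le_of_ne (hi b) hb.symm) 1 h1 w hw

theorem isEndpoint_one {i : Fin d} (hi : ∀ b, b ≤ i) : S.IsEndpoint i 1 where
  mem := by simp
  fix := S.branch_top_one hi
  sep := by
    have h0 : (0 : ℝ) ∈ UI := by simp
    refine ⟨1 - S.branch i 0, ?_, fun b hb w hw => ?_⟩
    · have := S.branch_mono i h0 (by simp) one_pos
      rw [S.branch_top_one hi] at this
      linarith
    · rw [abs_of_nonpos (sub_nonpos.2 (S.branch_maps_to b hw).2)]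
      linarith [S.ordered b i (lt_of_le_of_ne (hi b) hb) w hw 0 h0]

variable {S}

theorem IsEndpoint.proj_eq {i : Fin d} {e : ℝ} (h : S.IsEndpoint i e) (hε : 0 < ε) :
    proj S (fun _ => i) = e := S.proj_const hε h.mem h.fix

theorem IsEndpoint.word_eq {i : Fin d} {e : ℝ} (h : S.IsEndpoint i e) (n : ℕ) :
    S.word (fun _ => i) n e = e := by
  induction n with
  | zero => rfl
  | succ n ih => rw [word_succ', h.fix, ih]

theorem birk_const (f : (ℕ → Fin d) → ℝ) (n : ℕ) (i : Fin d) :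
    birk f n (fun _ => i) = n * f (fun _ => i) := by
  have : ∀ m, shift^[m] (fun _ : ℕ => i) = fun _ => i := fun m =>
    Function.iterate_fixed rfl m
  simp [birk, this]

theorem shift_iterate (x : ℕ → Fin d) (n m : ℕ) : (shift^[n] x) m = x (n + m) := by
  induction n generalizing x with
  | zero => simp
  | succ n ih => rw [Function.iterate_succ_apply, ih, shift]; congr 1; omega

/-- An initial `i`-block of length `k` puts the coded point at distance `≍ e^{kφ(ī)}` from the
endpoint. -/
theorem IsEndpoint.exists_block_bounds {i : Fin d} {e : ℝ} (h : S.IsEndpoint i e) (hε : 0 < ε) :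
    ∃ c > 0, ∃ C > 0, ∀ (y : ℕ → Fin d) (k : ℕ), HasBlock y i k 0 →
      c * Real.exp (k * pot S (fun _ => i)) ≤ |proj S y - e| ∧
      |proj S y - e| ≤ C * Real.exp (k * pot S (fun _ => i)) := by
  obtain ⟨m, hm, hsep⟩ := h.sep
  obtain ⟨K, hK, hdist⟩ := S.exists_distortion hε i.pos
  refine ⟨K⁻¹ * m, by positivity, K, hK, fun y k hy => ?_⟩
  simp only [HasBlock, zero_add] at hy
  have hp := S.proj_mem (shift^[k] y)
  have hm' : m ≤ |proj S (shift^[k] y) - e| := by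
    rw [S.proj_eq_branch, shift_iterate]
    exact hsep _ hy.2 _ (S.proj_mem _)
  have hle : |proj S (shift^[k] y) - e| ≤ 1 := by
    rw [abs_le]; constructor <;> linarith [hp.1, hp.2, h.mem.1, h.mem.2]
  obtain ⟨h₁, h₂⟩ := hdist (fun _ => i) k _ hp e h.mem
  rw [h.word_eq, ← S.word_congr hy.1, ← S.proj_eq_word, birk_const] at h₁ h₂
  constructor
  · refine le_trans (le_of_eq_of_le (by ring) (mul_le_mul_of_nonneg_left hm' ?_)) h₁
    positivity
  · exact h₂.trans (mul_le_of_le_one_right (by positivity) hle)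

end ExpMap

namespace IsConjugacy

variable {d : ℕ} {ε : ℝ} {S T : ExpMap d ε} {Θ : ℝ → ℝ}

theorem abs_sub_le_one {u v : ℝ} (hu : u ∈ UI) (hv : v ∈ UI) : |u - v| ≤ 1 := by
  rw [abs_le]; constructor <;> linarith [hu.1, hu.2, hv.1, hv.2]

theorem exists_DQ_endpoint_le (hΘ : IsConjugacy S T Θ) (hε : 0 < ε) {i : Fin d} {e : ℝ}
    (hS : S.IsEndpoint i e) :
    ∃ C > 0, ∀ (y : ℕ → Fin d) (k : ℕ), HasBlock y i k 0 →
      DQ Θ (proj S y) e ≤ C * Real.exp (birk (fun z => pot T z - pot S z) k y) := by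
  obtain ⟨m, hm, hsep⟩ := hS.sep
  obtain ⟨K, hK, hdist⟩ := hΘ.exists_DQ_distortion hε i.pos
  refine ⟨K * m⁻¹, by positivity, fun y k hy => ?_⟩
  simp only [HasBlock, zero_add] at hy
  have hp := S.proj_mem (shift^[k] y)
  have hm' : m ≤ |proj S (shift^[k] y) - e| := by
    rw [S.proj_eq_branch, ExpMap.shift_iterate]
    exact hsep _ hy.2 _ (S.proj_mem _)
  have hne : proj S (shift^[k] y) ≠ e := fun h => by
    rw [h, sub_self, abs_zero] at hm'; exact hm.not_ge hm'
  have h₂ := (hdist y k _ hp e hS.mem hne).2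
  rw [← S.proj_eq_word, S.word_congr hy.1, hS.word_eq] at h₂
  have hD : DQ Θ (proj S (shift^[k] y)) e ≤ m⁻¹ := by
    rw [hΘ.DQ_eq_abs hp hS.mem, ← one_div]
    exact div_le_div₀ zero_le_one (abs_sub_le_one (hΘ.mem hp) (hΘ.mem hS.mem)) hm hm'
  calc _ ≤ _ := h₂
    _ ≤ K * Real.exp (birk (fun z => pot T z - pot S z) k y) * m⁻¹ := by gcongr
    _ = _ := by ring

/-- Near a fixed endpoint the conjugacy behaves like a power function. -/
theorem exists_power_bounds (hΘ : IsConjugacy S T Θ) (hε : 0 < ε) {i : Fin d} {e : ℝ}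
    (hS : S.IsEndpoint i e) (hT : T.IsEndpoint i e) (hΘe : Θ e = e) {ρ : ℝ} (hρ : 0 < ρ)
    (hρeq : pot S (fun _ => i) * ρ = pot T (fun _ => i)) :
    ∃ c > 0, ∃ C > 0, ∀ w ∈ UI, c * |w - e| ^ ρ ≤ |Θ w - e| ∧ |Θ w - e| ≤ C * |w - e| ^ ρ := by
  obtain ⟨m, hm, hsep⟩ := hS.sep
  obtain ⟨m', hm', hsep'⟩ := hT.sep
  obtain ⟨K, hK, hdist⟩ := S.exists_distortion hε i.pos
  obtain ⟨K', hK', hdist'⟩ := T.exists_distortion hε i.pos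
  refine ⟨K'⁻¹ * m' * (K⁻¹) ^ ρ, by positivity, K' * (K * m⁻¹) ^ ρ, by positivity, fun w hw => ?_⟩
  rcases eq_or_ne w e with rfl | hne
  · simp [hΘe, Real.zero_rpow hρ.ne']
  obtain ⟨j, v, hv, hvS, rfl, -⟩ := S.exists_exit hε i.pos (fun _ => i) hw
    (by rwa [hS.proj_eq hε])
  obtain ⟨b, z, hz, rfl⟩ := S.exists_eq_branch hv
  have hb : b ≠ i := by rintro rfl; exact hvS ⟨z, hz, rfl⟩
  obtain ⟨h₁, h₂⟩ := hdist (fun _ => i) j _ hv e hS.mem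
  obtain ⟨h₁', h₂'⟩ := hdist' (fun _ => i) j _ (hΘ.mem hv) e hT.mem
  rw [hS.word_eq, ExpMap.birk_const] at h₁ h₂
  rw [hT.word_eq, ExpMap.birk_const, ← hΘ.map_word _ _ hv, ← hρeq, ← mul_assoc,
    Real.exp_mul] at h₁' h₂'
  set δ := Real.exp (j * pot S (fun _ => i))
  have hδ : 0 < δ := Real.exp_pos _
  have hm₁ : m ≤ |S.branch b z - e| := hsep b hb z hz
  have hm₂ : m' ≤ |Θ (S.branch b z) - e| := by
    rw [hΘ.map_branch b hz]; exact hsep' b hb _ (hΘ.mem hz)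
  have hD := abs_sub_le_one hv hS.mem
  have hD' := abs_sub_le_one (hΘ.mem hv) hT.mem
  set w := S.word (fun _ => i) j (S.branch b z)
  have hδ₁ : |w - e| ≤ K * δ := h₂.trans (mul_le_of_le_one_right (by positivity) hD)
  have hδ₂ : δ ≤ K * m⁻¹ * |w - e| := by
    have : K⁻¹ * δ * m ≤ |w - e| := le_trans (by gcongr) h₁
    calc δ = K * m⁻¹ * (K⁻¹ * δ * m) := by field_simp
      _ ≤ _ := by gcongr
  constructor
  · calc K'⁻¹ * m' * (K⁻¹) ^ ρ * |w - e| ^ ρ = K'⁻¹ * (K⁻¹ * |w - e|) ^ ρ * m' := by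
          rw [Real.mul_rpow (by positivity) (abs_nonneg _)]; ring
      _ ≤ K'⁻¹ * δ ^ ρ * |Θ (S.branch b z) - e| := by
          gcongr
          rwa [inv_mul_le_iff₀ hK]
      _ ≤ _ := h₁'
  · calc |Θ w - e| ≤ _ := h₂'
      _ ≤ K' * δ ^ ρ := mul_le_of_le_one_right (by positivity) hD'
      _ ≤ K' * (K * m⁻¹ * |w - e|) ^ ρ := by gcongr
      _ = _ := by rw [Real.mul_rpow (by positivity) (abs_nonneg _)]; ring

/-- A power bound at an endpoint is inherited by its images under all branches. -/
theorem exists_branch_power_le (hΘ : IsConjugacy S T Θ) {e C m ρ : ℝ} (he : e ∈ UI)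
    (hΘe : Θ e = e) (hρ : 0 < ρ) (hC : 0 < C) (h : ∀ w ∈ UI, |Θ w - e| ≤ C * |w - e| ^ ρ)
    (hm : 0 < m) (hb : ∀ a, ∀ ξ ∈ UI, m ≤ S.branchDeriv a ξ) :
    ∃ C' > 0, ∀ a, ∀ v ∈ UI, (v ∈ S.branch a '' UI ∨ m ≤ |v - S.branch a e|) →
      |Θ v - Θ (S.branch a e)| ≤ C' * |v - S.branch a e| ^ ρ := by
  refine ⟨(C + 1) * (m⁻¹) ^ ρ, by positivity, fun a v hv hor => ?_⟩
  rw [mul_assoc, ← Real.mul_rpow (by positivity) (abs_nonneg _)]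
  have hle := abs_sub_le_one (hΘ.mem hv) (hΘ.mem (S.branch_maps_to a he))
  rcases hor with ⟨w, hw, rfl⟩ | hfar
  · have h₁ := (S.branch_sub_bounds (m := m) (r := 1)
      (fun a ξ hξ => ⟨hb a ξ hξ, (S.branchDeriv_mem a ξ hξ).2.le⟩) a hw he).1
    have h₂ := (T.branch_sub_bounds (m := 0) (r := 1)
      (fun a ξ hξ => ⟨(T.branchDeriv_mem a ξ hξ).1.le, (T.branchDeriv_mem a ξ hξ).2.le⟩)
      a (hΘ.mem hw) he).2
    calc |Θ (S.branch a w) - Θ (S.branch a e)| ≤ |Θ w - e| := by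
          rw [hΘ.map_branch a hw, hΘ.map_branch a he, hΘe]; simpa using h₂
      _ ≤ C * |w - e| ^ ρ := h w hw
      _ ≤ (C + 1) * (m⁻¹ * |S.branch a w - S.branch a e|) ^ ρ := by
          gcongr
          · linarith
          · rwa [le_inv_mul_iff₀ hm]
  · have : (1 : ℝ) ≤ (m⁻¹ * |v - S.branch a e|) ^ ρ :=
      Real.one_le_rpow (by rwa [le_inv_mul_iff₀ hm, mul_one]) hρ.le
    nlinarith

end IsConjugacy

namespace ExpMap

variable {d : ℕ} {ε : ℝ} (S : ExpMap d ε)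

theorem exists_prev {a b : Fin d} (h : b < a) : ∃ c, c < a ∧ ∀ c', c < c' → a ≤ c' :=
  ⟨⟨a - 1, by omega⟩, by rw [Fin.lt_def] at h ⊢; simp only; omega, fun c' hc => by
    rw [Fin.lt_def] at h hc; rw [Fin.le_def]; simp only at hc; omega⟩

theorem branch_one_lt {a : Fin d} {z v : ℝ} (hz : z ∈ UI) (hv : v ∉ S.branch a '' UI)
    (h : S.branch a z < v) : S.branch a 1 < v := by
  by_contra! hle
  exact hv (S.mem_branch_image
    ⟨((S.branch_mono a).monotoneOn (by simp) hz hz.1).trans h.le, hle⟩)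

theorem lt_branch_zero {a : Fin d} {z v : ℝ} (hz : z ∈ UI) (hv : v ∉ S.branch a '' UI)
    (h : v < S.branch a z) : v < S.branch a 0 := by
  by_contra! hle
  exact hv (S.mem_branch_image
    ⟨hle, h.le.trans ((S.branch_mono a).monotoneOn hz (by simp) hz.2)⟩)

theorem hasBlock_of_not_evConst {x : ℕ → Fin d} (hx : ¬ EvConst x) (i : Fin d) (n : ℕ) :
    ∃ k, HasBlock x i k n := by
  classical
  have hex : ∃ k, x (n + k) ≠ i := by
    by_contra! h
    exact hx ⟨n, i, fun m hm => by obtain ⟨k, rfl⟩ := Nat.exists_eq_add_of_le hm; exact h k⟩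
  exact ⟨Nat.find hex, fun m hm => not_not.1 (Nat.find_min hex hm), Nat.find_spec hex⟩

theorem hasBlock_shift {x : ℕ → Fin d} {i : Fin d} {k n : ℕ} (h : HasBlock x i k n) :
    HasBlock (shift^[n] x) i k 0 := by
  simpa only [HasBlock, shift_iterate, zero_add] using h

/-- The coded point is not an endpoint as soon as the coding is not eventually constant. -/
theorem proj_ne_endpoint (hε : 0 < ε) {x : ℕ → Fin d} (hx : ¬ EvConst x) {i : Fin d} {e : ℝ}
    (h : S.IsEndpoint i e) (n : ℕ) : proj S (shift^[n] x) ≠ e := by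
  obtain ⟨c, hc, C, hC, hb⟩ := h.exists_block_bounds hε
  obtain ⟨k, hk⟩ := hasBlock_of_not_evConst hx i n
  have := (hb _ k (hasBlock_shift hk)).1
  rintro heq
  rw [heq, sub_self, abs_zero] at this
  exact absurd this (not_le.2 (by positivity))

end ExpMap

namespace IsConjugacy

variable {d : ℕ} {ε : ℝ} {S T : ExpMap d ε} {Θ : ℝ → ℝ}

theorem DQ_comm (u v : ℝ) : DQ Θ u v = DQ Θ v u := by
  rw [DQ, DQ, ← neg_sub (Θ v), ← neg_sub v, neg_div_neg_eq]

/-- Upper bound for the difference quotient at points `u ≤ p ≤ v`, where `Θ` satisfies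
one-sided Hölder bounds at `p`. -/
theorem DQ_le_of_between {ρ C u v p s : ℝ} (hρ : 0 < ρ) (hρ1 : ρ < 1) (hC : 0 < C)
    (hup : u ≤ p) (hpv : p ≤ v) (hs : 0 < s) (hsv : s ≤ v - u)
    (h₁ : Θ p - Θ u ≤ C * (p - u) ^ ρ) (h₂ : Θ v - Θ p ≤ C * (v - p) ^ ρ) :
    DQ Θ v u ≤ 2 * C * s ^ (ρ - 1) := by
  have huv : 0 < v - u := hs.trans_le hsv
  have h₃ : (p - u) ^ ρ ≤ (v - u) ^ ρ :=
    Real.rpow_le_rpow (by linarith) (by linarith) hρ.le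
  have h₄ : (v - p) ^ ρ ≤ (v - u) ^ ρ :=
    Real.rpow_le_rpow (by linarith) (by linarith) hρ.le
  calc DQ Θ v u ≤ 2 * C * (v - u) ^ ρ / (v - u) := by
        rw [DQ]; gcongr; nlinarith
    _ = 2 * C * (v - u) ^ (ρ - 1) := by rw [Real.rpow_sub_one huv.ne']; ring
    _ ≤ 2 * C * s ^ (ρ - 1) := by
        gcongr 2 * C * ?_
        exact Real.rpow_le_rpow_of_nonpos hs hsv (by linarith)

/-- Upper bounds for difference quotients between points of different cylinders. -/
theorem exists_DQ_branch_le (hΘ : IsConjugacy S T Θ) (hε : 0 < ε) (hd : 0 < d) {C ρ : ℝ}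
    (hρ : 0 < ρ) (hρ1 : ρ < 1) (hC : 0 < C)
    (h0 : ∀ w ∈ UI, |Θ w - 0| ≤ C * |w - 0| ^ ρ) (h1 : ∀ w ∈ UI, |Θ w - 1| ≤ C * |w - 1| ^ ρ) :
    ∃ C' > 0, ∀ a, ∀ z ∈ UI, ∀ v ∈ UI, v ∉ S.branch a '' UI →
      (S.branch a z < v → z ≠ 1 → DQ Θ (S.branch a z) v ≤ C' * |z - 1| ^ (ρ - 1)) ∧
      (v < S.branch a z → z ≠ 0 → DQ Θ (S.branch a z) v ≤ C' * |z - 0| ^ (ρ - 1)) := by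
  obtain ⟨m, r, hm, hr, hr1, hb⟩ := S.exists_branchDeriv_bounds hε hd
  have hb' := fun a ξ hξ => (hb a ξ hξ).1
  have z0 : (0 : ℝ) ∈ UI := by simp
  have z1 : (1 : ℝ) ∈ UI := by simp
  obtain ⟨C₀, hC₀, H0⟩ := hΘ.exists_branch_power_le z0 hΘ.map_zero hρ hC h0 hm hb'
  obtain ⟨C₁, hC₁, H1⟩ := hΘ.exists_branch_power_le z1 hΘ.map_one hρ hC h1 hm hb'
  have hlen : ∀ a, m ≤ S.branch a 1 - S.branch a 0 := fun a => by
    have := (S.branch_sub_bounds hb a z1 z0).1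
    rwa [sub_zero, abs_one, mul_one,
      abs_of_pos (sub_pos.2 (S.branch_mono a z0 z1 one_pos))] at this
  set M := max C₀ C₁
  have hM : 0 < M := lt_max_of_lt_left hC₀
  have K0 : ∀ a, ∀ v ∈ UI, S.branch a 0 ≤ v →
      Θ v - Θ (S.branch a 0) ≤ M * (v - S.branch a 0) ^ ρ := by
    intro a v hv hle
    refine (le_abs_self _).trans ((H0 a v hv ?_).trans ?_)
    · rcases le_total v (S.branch a 1) with h | h
      · exact Or.inl (S.mem_branch_image ⟨hle, h⟩)
      · exact Or.inr (le_trans (by linarith [hlen a]) (le_abs_self _))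
    · rw [abs_of_nonneg (sub_nonneg.2 hle)]
      gcongr
      exact le_max_left _ _
  have K1 : ∀ a, ∀ v ∈ UI, v ≤ S.branch a 1 →
      Θ (S.branch a 1) - Θ v ≤ M * (S.branch a 1 - v) ^ ρ := by
    intro a v hv hle
    have h₁ := H1 a v hv (by
      rcases le_total (S.branch a 0) v with h | h
      · exact Or.inl (S.mem_branch_image ⟨h, hle⟩)
      · exact Or.inr (le_trans (by linarith [hlen a]) (neg_le_abs _)))
    rw [abs_sub_comm, abs_sub_comm v, abs_of_nonneg (sub_nonneg.2 hle)] at h₁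
    refine (le_abs_self _).trans (h₁.trans ?_)
    gcongr
    exact le_max_right _ _
  have pull : ∀ s : ℝ, 0 < s → 2 * M * (m * s) ^ (ρ - 1) = 2 * M * m ^ (ρ - 1) * s ^ (ρ - 1) :=
    fun s hs => by rw [Real.mul_rpow hm.le hs.le]; ring
  refine ⟨2 * M * m ^ (ρ - 1), by positivity, fun a z hz v hv hva => ⟨fun hlt hz1 => ?_,
    fun hlt hz0 => ?_⟩⟩
  · have hs : 0 < |z - 1| := abs_pos.2 (sub_ne_zero.2 hz1)
    have hav := S.branch_one_lt hz hva hlt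
    have hza : S.branch a z ≤ S.branch a 1 := (S.branch_mono a).monotoneOn hz z1 hz.2
    obtain ⟨t, ht⟩ : ∃ t, a < t := by
      by_contra! htop
      exact (hv.2.trans_lt ((S.branch_top_one htop) ▸ hav)).false
    obtain ⟨b, hab, hb₁⟩ := ExpMap.exists_next ht
    have hp := S.branch_one_eq_branch_zero hab hb₁
    rw [← pull _ hs, DQ_comm]
    refine DQ_le_of_between hρ hρ1 hM hza hav.le (by positivity) ?_
      (K1 a _ (S.branch_maps_to a hz) hza) (by rw [hp]; exact K0 b v hv (hp ▸ hav.le))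
    refine (S.branch_sub_bounds hb a hz z1).1.trans ?_
    rw [abs_of_nonpos (sub_nonpos.2 hza)]
    linarith
  · have hs : 0 < |z - 0| := abs_pos.2 (sub_ne_zero.2 hz0)
    have hav := S.lt_branch_zero hz hva hlt
    have hza : S.branch a 0 ≤ S.branch a z := (S.branch_mono a).monotoneOn z0 hz hz.1
    obtain ⟨t, ht⟩ : ∃ t, t < a := by
      by_contra! hbot
      exact (hv.1.trans_lt ((S.branch_bot_zero hbot) ▸ hav)).false
    obtain ⟨b, hab, hb₁⟩ := ExpMap.exists_prev ht
    have hp := S.branch_one_eq_branch_zero hab hb₁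
    rw [← pull _ hs]
    refine DQ_le_of_between hρ hρ1 hM hav.le hza (by positivity) ?_
      (by rw [← hp]; exact K1 b v hv (hp ▸ hav.le)) (K0 a _ (S.branch_maps_to a hz) hza)
    refine (S.branch_sub_bounds hb a hz z0).1.trans ?_
    rw [abs_of_nonneg (sub_nonneg.2 hza)]
    linarith

/-- Points of the cylinder following that of `S.branch a z` with a large difference quotient. -/
theorem exists_le_DQ_branch (hΘ : IsConjugacy S T Θ) (hε : 0 < ε) (hd : 0 < d) {c ρ : ℝ}
    (hc : 0 < c) (h0 : ∀ w ∈ UI, c * |w - 0| ^ ρ ≤ |Θ w - 0|) :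
    ∃ c' > 0, ∀ a b : Fin d, a < b → ∀ z ∈ UI, z ≠ 1 →
      ∃ v ∈ UI, S.branch a z < v ∧ c' * |z - 1| ^ (ρ - 1) ≤ DQ Θ (S.branch a z) v := by
  obtain ⟨m, r, hm, hr, hr1, hb⟩ := T.exists_branchDeriv_bounds hε hd
  have z0 : (0 : ℝ) ∈ UI := by simp
  have z1 : (1 : ℝ) ∈ UI := by simp
  refine ⟨m * c / 2, by positivity, fun a t hat z hz hz1 => ?_⟩
  obtain ⟨b, hab, hb₁⟩ := ExpMap.exists_next hat
  have hp := S.branch_one_eq_branch_zero hab hb₁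
  have hz1' : z < 1 := lt_of_le_of_ne hz.2 hz1
  have hw : 1 - z ∈ UI := ⟨by linarith, by linarith [hz.1]⟩
  have hδ : 0 < 1 - z := by linarith
  have hlt₁ : S.branch a z < S.branch a 1 := S.branch_mono a hz z1 hz1'
  have hlt₂ : S.branch b 0 < S.branch b (1 - z) := S.branch_mono b z0 hw hδ
  have hlt : S.branch a z < S.branch b (1 - z) := hlt₁.trans (hp ▸ hlt₂)
  have hS := fun a ξ hξ => And.intro (S.branchDeriv_mem a ξ hξ).1.le (S.branchDeriv_mem a ξ hξ).2.le
  have hd₁ := (S.branch_sub_bounds hS a z1 hz).2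
  have hd₂ := (S.branch_sub_bounds hS b hw z0).2
  rw [abs_of_pos (sub_pos.2 hlt₁), one_mul, abs_of_pos hδ] at hd₁
  rw [abs_of_pos (sub_pos.2 hlt₂), one_mul, sub_zero, abs_of_pos hδ] at hd₂
  have hnum : m * (c * (1 - z) ^ ρ) ≤ Θ (S.branch b (1 - z)) - Θ (S.branch a z) := by
    have h₁ := hΘ.monotone (S.branch_maps_to a hz) (S.branch_maps_to b z0) (hp ▸ hlt₁.le)
    have h₂ := hΘ.monotone (S.branch_maps_to b z0) (S.branch_maps_to b hw) hlt₂.le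
    have h₃ := (T.branch_sub_bounds hb b (hΘ.mem hw) z0).1
    have h₄ := h0 _ hw
    rw [sub_zero, abs_of_pos hδ] at h₄
    rw [← hΘ.map_branch_zero, ← hΘ.map_branch b hw, abs_of_nonneg (sub_nonneg.2 h₂)] at h₃
    have := mul_le_mul_of_nonneg_left h₄ hm.le
    linarith
  refine ⟨_, S.branch_maps_to b hw, hlt, ?_⟩
  rw [DQ_comm, DQ, le_div_iff₀ (sub_pos.2 hlt), abs_sub_comm, abs_of_pos hδ]
  calc m * c / 2 * (1 - z) ^ (ρ - 1) * (S.branch b (1 - z) - S.branch a z)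
      ≤ m * c / 2 * (1 - z) ^ (ρ - 1) * (2 * (1 - z)) := by
        gcongr
        rw [hp] at hd₁
        linarith
    _ = m * (c * (1 - z) ^ ρ) := by
        rw [Real.rpow_sub_one hδ.ne']; field_simp
    _ ≤ _ := hnum

theorem exists_abs_pot_sub_le (S T : ExpMap d ε) (hε : 0 < ε) (hd : 0 < d) :
    ∃ B, ∀ y, |pot T y - pot S y| ≤ B := by
  obtain ⟨m, r, hm, hr, hr1, hb⟩ := S.exists_branchDeriv_bounds hε hd
  obtain ⟨m', r', hm', hr', hr1', hb'⟩ := T.exists_branchDeriv_bounds hε hd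
  refine ⟨-Real.log m - Real.log m', fun y => ?_⟩
  have h₁ := Real.log_le_log hm (hb (y 0) _ (S.proj_mem (shift y))).1
  have h₂ := Real.log_le_log hm' (hb' (y 0) _ (T.proj_mem (shift y))).1
  have h₃ := S.pot_neg y
  have h₄ := T.pot_neg y
  rw [pot] at h₃ h₄
  rw [pot, pot, abs_le]
  constructor <;> linarith

/-- The difference quotients at `π_S(x)` have limit `0` if they are uniformly small at all
sufficiently high exit levels. -/
theorem tendsto_DQ_zero (hΘ : IsConjugacy S T Θ) (hε : 0 < ε) (hd : 0 < d) {x : ℕ → Fin d}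
    (hx0 : ∀ n, proj S (shift^[n] x) ≠ 0) (hx1 : ∀ n, proj S (shift^[n] x) ≠ 1) (A : Set ℝ)
    (h : ∀ c > 0, ∃ N, ∀ n ≥ N, ∀ v ∈ UI, v ∉ S.branch (x n) '' UI → S.word x n v ∈ A →
      DQ Θ (proj S x) (S.word x n v) < c) :
    Tendsto (fun η => DQ Θ (proj S x) η) (𝓝[(UI \ {proj S x}) ∩ A] (proj S x)) (𝓝 0) := by
  refine tendsto_order.2 ⟨fun c hc => ?_, fun c hc => ?_⟩
  · filter_upwards [self_mem_nhdsWithin] with η hη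
    exact hc.trans_le (hΘ.DQ_nonneg (S.proj_mem x) hη.1.1)
  · obtain ⟨N, hN⟩ := h c hc
    have hp := S.proj_mem (shift^[N] x)
    have hnhds : Ioo (S.word x N 0) (S.word x N 1) ∈ 𝓝 (proj S x) := by
      rw [S.proj_eq_word x N]
      exact Ioo_mem_nhds
        (S.word_strictMonoOn x N (by simp) hp (lt_of_le_of_ne hp.1 (hx0 N).symm))
        (S.word_strictMonoOn x N hp (by simp) (lt_of_le_of_ne hp.2 (hx1 N)))
    filter_upwards [self_mem_nhdsWithin, mem_nhdsWithin_of_mem_nhds hnhds] with η hη hη'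
    obtain ⟨n, v, hv, hvS, rfl, hn⟩ := S.exists_exit hε hd x hη.1.1 hη.1.2
    exact hN n (hn N (intermediate_value_Icc zero_le_one (S.word_continuousOn x N)
      (Ioo_subset_Icc_self hη'))) v hv hvS hη.2

/-- Two-sided control of the difference quotients at `π_S(x)` by Birkhoff sums and block lengths. -/
theorem exists_DQ_block_bounds (hΘ : IsConjugacy S T Θ) (hε : 0 < ε) {x : ℕ → Fin d}
    (hx : ¬ EvConst x) {i j : Fin d} (hi : ∀ b, i ≤ b) (hj : ∀ b, b ≤ j)
    (hcase : pot T (fun _ => i) / pot S (fun _ => i) <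
      min (pot T (fun _ => j) / pot S (fun _ => j)) 1) {α : ℝ}
    (hα : α = (pot T (fun _ => i) - pot S (fun _ => i)) * pot S (fun _ => j) /
      pot S (fun _ => i)) :
    ∃ C > 0, ∃ c > 0, ∀ n,
      (∀ v ∈ UI, v ∉ S.branch (x n) '' UI → proj S (shift^[n] x) < v →
        x n ≠ j ∧ ∀ k, HasBlock x j k (n + 1) → DQ Θ (proj S x) (S.word x n v) ≤
          C * Real.exp (birk (fun z => pot T z - pot S z) (n + 1) x + k * α)) ∧
      (∀ v ∈ UI, v ∉ S.branch (x n) '' UI → v < proj S (shift^[n] x) →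
        ∀ k, HasBlock x i k (n + 1) → DQ Θ (proj S x) (S.word x n v) ≤
          C * Real.exp (birk (fun z => pot T z - pot S z) (n + 1 + k) x)) ∧
      (x n ≠ j → ∀ k, HasBlock x j k (n + 1) → ∃ v ∈ UI, proj S (shift^[n] x) < v ∧
        c * Real.exp (birk (fun z => pot T z - pot S z) (n + 1) x + k * α) ≤
          DQ Θ (proj S x) (S.word x n v)) := by
  have hd : 0 < d := i.pos
  have hSi := S.isEndpoint_zero hi
  have hSj := S.isEndpoint_one hj
  have hφi := S.pot_neg fun _ => i
  have hφj := S.pot_neg fun _ => j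
  have hψi := T.pot_neg fun _ => i
  have hφi' := hφi.ne
  have hφj' := hφj.ne
  obtain ⟨hρj, hρ1⟩ := lt_min_iff.1 hcase
  set ρ := pot T (fun _ => i) / pot S (fun _ => i) with hρdef
  set ρ' := pot T (fun _ => j) / pot S (fun _ => j) with hρdef'
  have hρ : 0 < ρ := div_pos_of_neg_of_neg hψi hφi
  have hρ' : 0 < ρ' := hρ.trans hρj
  have hα' : α = pot S (fun _ => j) * (ρ - 1) := by
    rw [hα, hρdef]; field_simp
  obtain ⟨c₀, hc₀, C₀, hC₀, h0⟩ := hΘ.exists_power_bounds hε hSi (T.isEndpoint_zero hi)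
    hΘ.map_zero hρ (by rw [hρdef]; field_simp)
  obtain ⟨c₁, hc₁, C₁, hC₁, h1⟩ := hΘ.exists_power_bounds hε hSj (T.isEndpoint_one hj)
    hΘ.map_one hρ' (by rw [hρdef']; field_simp)
  have h1' : ∀ w ∈ UI, |Θ w - 1| ≤ max C₀ C₁ * |w - 1| ^ ρ := fun w hw => by
    refine (h1 w hw).2.trans (mul_le_mul (le_max_right _ _) ?_ (by positivity) (by positivity))
    exact Real.rpow_le_rpow_of_exponent_ge_of_imp (abs_nonneg _)
      (abs_sub_le_one hw hSj.mem) hρj.le fun _ h => absurd h hρ'.ne'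
  obtain ⟨C₂, hC₂, hup⟩ := hΘ.exists_DQ_branch_le hε hd hρ hρ1 (lt_max_of_lt_left hC₀)
    (fun w hw => (h0 w hw).2.trans (by gcongr; exact le_max_left _ _)) h1'
  obtain ⟨c₃, hc₃, hlow⟩ := hΘ.exists_le_DQ_branch hε hd hc₀ fun w hw => (h0 w hw).1
  obtain ⟨K, hK, hdist⟩ := hΘ.exists_DQ_distortion hε hd
  obtain ⟨B, hB⟩ := exists_abs_pot_sub_le S T hε hd
  obtain ⟨c₄, hc₄, C₄, hC₄, hblock⟩ := hSj.exists_block_bounds hε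
  obtain ⟨C₅, hC₅, hend⟩ := hΘ.exists_DQ_endpoint_le (T := T) hε hSi
  have hx0 := fun n => S.proj_ne_endpoint hε hx hSi n
  have hx1 := fun n => S.proj_ne_endpoint hε hx hSj n
  have hstep : ∀ n, proj S (shift^[n] x) = S.branch (x n) (proj S (shift^[n + 1] x)) := fun n => by
    rw [S.proj_eq_branch, ExpMap.shift_iterate, Function.iterate_succ_apply']; rfl
  set χ : (ℕ → Fin d) → ℝ := fun z => pot T z - pot S z with hχ
  have hbirk : ∀ n, birk χ n x ≤ birk χ (n + 1) x + B ∧ birk χ (n + 1) x - B ≤ birk χ n x := by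
    intro n
    have := abs_le.1 (hB (shift^[n] x))
    rw [birk, birk, Finset.sum_range_succ]
    simp only [hχ]
    constructor <;> linarith
  have hpow : ∀ k : ℕ, Real.exp (k * pot S (fun _ => j)) ^ (ρ - 1) = Real.exp (k * α) := by
    intro k; rw [← Real.exp_mul, hα', mul_assoc]
  have hblockpow : ∀ n k, HasBlock x j k n →
      |proj S (shift^[n] x) - 1| ^ (ρ - 1) ≤ c₄ ^ (ρ - 1) * Real.exp (k * α) ∧
      C₄ ^ (ρ - 1) * Real.exp (k * α) ≤ |proj S (shift^[n] x) - 1| ^ (ρ - 1) := by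
    intro n k hk
    obtain ⟨h₁, h₂⟩ := hblock _ k (ExpMap.hasBlock_shift hk)
    rw [← hpow, ← Real.mul_rpow hc₄.le (Real.exp_pos _).le,
      ← Real.mul_rpow hC₄.le (Real.exp_pos _).le]
    exact ⟨Real.rpow_le_rpow_of_nonpos (by positivity) h₁ (by linarith),
      Real.rpow_le_rpow_of_nonpos (abs_pos.2 (sub_ne_zero.2 (hx1 n))) h₂ (by linarith)⟩
  have hdistup : ∀ n, ∀ v ∈ UI, proj S (shift^[n] x) ≠ v → DQ Θ (proj S x) (S.word x n v) ≤
      K * (Real.exp B * Real.exp (birk χ (n + 1) x)) * DQ Θ (proj S (shift^[n] x)) v := by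
    intro n v hv hne
    have := (hdist x n _ (S.proj_mem (shift^[n] x)) v hv hne).2
    rw [← S.proj_eq_word] at this
    refine this.trans ?_
    have hD := hΘ.DQ_nonneg (S.proj_mem (shift^[n] x)) hv
    rw [← Real.exp_add]
    gcongr
    linarith [(hbirk n).1]
  have hdistlow : ∀ n, ∀ v ∈ UI, proj S (shift^[n] x) ≠ v →
      K⁻¹ * (Real.exp (-B) * Real.exp (birk χ (n + 1) x)) * DQ Θ (proj S (shift^[n] x)) v ≤
        DQ Θ (proj S x) (S.word x n v) := by
    intro n v hv hne
    have := (hdist x n _ (S.proj_mem (shift^[n] x)) v hv hne).1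
    rw [← S.proj_eq_word] at this
    refine le_trans ?_ this
    have hD := hΘ.DQ_nonneg (S.proj_mem (shift^[n] x)) hv
    rw [← Real.exp_add]
    gcongr
    linarith [(hbirk n).2]
  set CR := K * Real.exp B * C₂ * c₄ ^ (ρ - 1)
  set CL := K * Real.exp B * C₂ * (c₀⁻¹ * C₅)
  refine ⟨max CR CL, lt_max_of_lt_left (by positivity),
    K⁻¹ * Real.exp (-B) * c₃ * C₄ ^ (ρ - 1), by positivity, fun n => ⟨?_, ?_, ?_⟩⟩
  · intro v hv hvS hlt
    refine ⟨?_, fun k hk => ?_⟩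
    · intro hxn
      have := S.branch_one_lt (S.proj_mem _) hvS ((hstep n) ▸ hlt)
      rw [hxn, hSj.fix] at this
      exact this.not_ge hv.2
    · have h₁ := (hup (x n) _ (S.proj_mem (shift^[n + 1] x)) v hv hvS).1 ((hstep n) ▸ hlt)
        (hx1 _)
      rw [← hstep] at h₁
      calc _ ≤ _ := hdistup n v hv hlt.ne
        _ ≤ K * (Real.exp B * Real.exp (birk χ (n + 1) x)) *
            (C₂ * (c₄ ^ (ρ - 1) * Real.exp (k * α))) := by
          gcongr
          exact h₁.trans (by gcongr; exact (hblockpow _ k hk).1)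
        _ = CR * Real.exp (birk χ (n + 1) x + k * α) := by rw [Real.exp_add]; ring
        _ ≤ _ := by gcongr; exact le_max_left _ _
  · intro v hv hvS hlt k hk
    have hu := S.proj_mem (shift^[n + 1] x)
    have hne := hx0 (n + 1)
    have hpos : 0 < |proj S (shift^[n + 1] x) - 0| := abs_pos.2 (sub_ne_zero.2 hne)
    have h₁ := (hup (x n) _ hu v hv hvS).2 ((hstep n) ▸ hlt) hne
    rw [← hstep] at h₁
    have h₂ := hend _ k (ExpMap.hasBlock_shift hk)
    have h₃ : |proj S (shift^[n + 1] x) - 0| ^ (ρ - 1) ≤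
        c₀⁻¹ * DQ Θ (proj S (shift^[n + 1] x)) 0 := by
      rw [hΘ.DQ_eq_abs hu hSi.mem, hΘ.map_zero, Real.rpow_sub_one hpos.ne', ← mul_div_assoc]
      gcongr
      rw [le_inv_mul_iff₀ hc₀]
      exact (h0 _ hu).1
    calc _ ≤ _ := hdistup n v hv hlt.ne'
      _ ≤ K * (Real.exp B * Real.exp (birk χ (n + 1) x)) *
          (C₂ * (c₀⁻¹ * (C₅ * Real.exp (birk χ k (shift^[n + 1] x))))) := by
        gcongr
        exact h₁.trans (by gcongr; exact h₃.trans (by gcongr))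
      _ = CL * Real.exp (birk χ (n + 1 + k) x) := by
          rw [ExpMap.birk_add χ (n + 1) k, Real.exp_add]
          ring
      _ ≤ _ := by gcongr; exact le_max_right _ _
  · intro hxn k hk
    obtain ⟨v, hv, hlt, hle⟩ := hlow (x n) j (lt_of_le_of_ne (hj _) hxn) _
      (S.proj_mem (shift^[n + 1] x)) (hx1 _)
    rw [← hstep] at hlt hle
    refine ⟨v, hv, hlt, ?_⟩
    calc _ = K⁻¹ * (Real.exp (-B) * Real.exp (birk χ (n + 1) x)) *
          (c₃ * (C₄ ^ (ρ - 1) * Real.exp (k * α))) := by rw [Real.exp_add]; ring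
      _ ≤ K⁻¹ * (Real.exp (-B) * Real.exp (birk χ (n + 1) x)) *
          DQ Θ (proj S (shift^[n] x)) v := by
        gcongr
        exact le_trans (by gcongr; exact (hblockpow _ k hk).2) hle
      _ ≤ _ := hdistlow n v hv hlt.ne

end IsConjugacy

/-- Proposition `Prop3`.  Assume Case 1, i.e.
`ψ(1̄)/φ(1̄) < min{ψ(d̄)/φ(d̄), 1}`, and set `α := (ψ(1̄)-φ(1̄))·φ(d̄)/φ(1̄)`.  Let `x ∈ Σ`
be not eventually constant with `lim_n S_nχ(x) = -∞`, and set `ξ := π_S(x)`.  Then `Θ'(ξ)`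
does not exist in the generalised sense iff there exist `c > 0` and strictly increasing
sequences `(n_m)`, `(k_m)` of positive integers such that for every `m`, `x` has a strict
`d`-block of length `k_m` at the `n_m`-th level and `e^{S_{n_m}χ(x) + k_m α} ≥ c`. -/
theorem statement_6 {d : ℕ} {ε : ℝ} (hd : 2 ≤ d) (hε : 0 < ε)
    (S T : ExpMap d ε) (Θ : ℝ → ℝ) (hΘ : IsConjugacy S T Θ)
    (x : ℕ → Fin d) (hx : ¬ EvConst x)
    (hcase : pot T (fun _ => (⟨0, by omega⟩ : Fin d)) / pot S (fun _ => (⟨0, by omega⟩ : Fin d)) <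
      min (pot T (fun _ => (⟨d - 1, by omega⟩ : Fin d)) /
        pot S (fun _ => (⟨d - 1, by omega⟩ : Fin d))) 1)
    (hsum : Filter.Tendsto (fun n => birk (fun z => pot T z - pot S z) n x)
      Filter.atTop Filter.atBot) :
    let one : Fin d := ⟨0, by omega⟩
    let top : Fin d := ⟨d - 1, by omega⟩
    let α : ℝ := (pot T (fun _ => one) - pot S (fun _ => one)) * pot S (fun _ => top) /
      pot S (fun _ => one)
    (¬ GenDeriv Θ (proj S x)) ↔
      ∃ c : ℝ, 0 < c ∧ ∃ ns ks : ℕ → ℕ, StrictMono ns ∧ StrictMono ks ∧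
        (∀ m, 0 < ns m) ∧ (∀ m, 0 < ks m) ∧
        ∀ m : ℕ, (x (ns m - 1) ≠ top ∧ HasBlock x top (ks m) (ns m)) ∧
          c ≤ Real.exp (birk (fun z => pot T z - pot S z) (ns m) x + (ks m : ℝ) * α) := by
  intro one top α
  have hd0 : 0 < d := by omega
  have hone : ∀ b : Fin d, one ≤ b := fun b => Nat.zero_le _
  have htop : ∀ b : Fin d, b ≤ top := fun b => Fin.le_def.2 (Nat.le_sub_one_of_lt b.2)
  have hx0 := fun n => S.proj_ne_endpoint hε hx (S.isEndpoint_zero hone) n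
  have hx1 := fun n => S.proj_ne_endpoint hε hx (S.isEndpoint_one htop) n
  obtain ⟨C, hC, c, hc, hbounds⟩ :=
    hΘ.exists_DQ_block_bounds hε hx hone htop hcase (α := α) rfl
  have hmono : ∀ n, ∀ v ∈ UI, (proj S x < S.word x n v ↔ proj S (shift^[n] x) < v) ∧
      (S.word x n v < proj S x ↔ v < proj S (shift^[n] x)) := fun n v hv => by
    rw [S.proj_eq_word x n]
    exact ⟨(S.word_strictMonoOn x n).lt_iff_lt (S.proj_mem _) hv,
      (S.word_strictMonoOn x n).lt_iff_lt hv (S.proj_mem _)⟩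
  have hleft : ∀ δ > 0, ∃ N, ∀ n ≥ N, ∀ v ∈ UI, v ∉ S.branch (x n) '' UI →
      S.word x n v < proj S x → DQ Θ (proj S x) (S.word x n v) < δ := by
    intro δ hδ
    have hlim : Tendsto (fun n => C * Real.exp (birk (fun z => pot T z - pot S z) n x))
        atTop (𝓝 0) := by
      simpa using (Real.tendsto_exp_atBot.comp hsum).const_mul C
    obtain ⟨N, hN⟩ := eventually_atTop.1 (hlim.eventually_lt_const hδ)
    refine ⟨N, fun n hn v hv hvS hlt => ?_⟩
    obtain ⟨k, hk⟩ := ExpMap.hasBlock_of_not_evConst hx one (n + 1)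
    exact ((hbounds n).2.1 v hv hvS ((hmono n v hv).2.1 hlt) k hk).trans_lt (hN _ (by omega))
  constructor
  · intro hnot
    by_contra hno
    refine hnot (Or.inl ⟨0, ?_⟩)
    have hrare : ∀ δ > 0, ∀ᶠ n in atTop, ¬ (0 < n ∧ x (n - 1) ≠ top ∧ ∃ k, HasBlock x top k n ∧
        δ ≤ Real.exp (birk (fun z => pot T z - pot S z) n x + k * α)) := by
      intro δ hδ
      by_contra hfreq
      obtain ⟨ns, hns, hP⟩ := extraction_of_frequently_atTop hfreq
      choose hpos hne ks hblock hge using hP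
      have hα : 0 < α := by
        have h₁ := S.pot_neg fun _ => one
        have h₂ := S.pot_neg fun _ => top
        have h₃ := (lt_min_iff.1 hcase).2
        rw [div_lt_one_of_neg h₁] at h₃
        exact div_pos_of_neg_of_neg (mul_neg_of_pos_of_neg (sub_pos.2 h₃) h₂) h₁
      have hks : Tendsto ks atTop atTop := by
        have h₁ : Tendsto (fun m => α⁻¹ * (Real.log δ +
            -birk (fun z => pot T z - pot S z) (ns m) x)) atTop atTop :=
          (tendsto_atTop_add_const_left _ _
            (tendsto_neg_atBot_atTop.comp (hsum.comp hns.tendsto_atTop))).const_mul_atTop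
            (inv_pos.2 hα)
        refine tendsto_natCast_atTop_iff.1 (tendsto_atTop_mono (fun m => ?_) h₁)
        rw [inv_mul_le_iff₀ hα]
        have := (Real.log_le_iff_le_exp hδ).2 (hge m)
        linarith
      obtain ⟨θ, hθ, hkθ⟩ := strictMono_subseq_of_tendsto_atTop hks
      have hsucc : StrictMono fun m : ℕ => m + 1 := fun a b h => Nat.succ_lt_succ h
      exact hno ⟨δ, hδ, fun m => ns (θ (m + 1)), fun m => ks (θ (m + 1)),
        hns.comp (hθ.comp hsucc), hkθ.comp hsucc, fun m => hpos _,
        fun m => (Nat.zero_le _).trans_lt (hkθ m.succ_pos),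
        fun m => ⟨⟨hne _, hblock _⟩, hge _⟩⟩
    have := hΘ.tendsto_DQ_zero hε hd0 hx0 hx1 univ fun δ hδ => by
      obtain ⟨N₁, hN₁⟩ := hleft δ hδ
      obtain ⟨N₂, hN₂⟩ := eventually_atTop.1 (hrare (δ / C) (div_pos hδ hC))
      refine ⟨max N₁ N₂, fun n hn v hv hvS _ => ?_⟩
      rcases lt_trichotomy (S.word x n v) (proj S x) with h | h | h
      · exact hN₁ n ((le_max_left _ _).trans hn) v hv hvS h
      · rw [DQ, h, sub_self, zero_div]
        exact hδ
      · obtain ⟨hxn, hle⟩ := (hbounds n).1 v hv hvS ((hmono n v hv).1.1 h)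
        obtain ⟨k, hk⟩ := ExpMap.hasBlock_of_not_evConst hx top (n + 1)
        refine (hle k hk).trans_lt ?_
        by_contra! hcon
        refine hN₂ (n + 1) (((le_max_right _ _).trans hn).trans n.le_succ)
          ⟨n.succ_pos, hxn, k, hk, ?_⟩
        rw [div_le_iff₀ hC, mul_comm]
        exact hcon
    rwa [inter_univ] at this
  · rintro ⟨δ, hδ, ns, ks, hns, -, hpos, -, hblocks⟩ hgen
    obtain ⟨_, r, -, hr, hr1, hb⟩ := S.exists_branchDeriv_bounds hε hd0
    have hzero : Tendsto (fun η => DQ Θ (proj S x) η)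
        (𝓝[(UI \ {proj S x}) ∩ Iio (proj S x)] (proj S x)) (𝓝 0) :=
      hΘ.tendsto_DQ_zero hε hd0 hx0 hx1 _ hleft
    have hmem := S.proj_mem x
    have h0 : 0 < proj S x := lt_of_le_of_ne hmem.1 (hx0 0).symm
    have hnb : (𝓝[(UI \ {proj S x}) ∩ Iio (proj S x)] (proj S x)).NeBot := by
      refine (nhdsLT_neBot_of_exists_lt ⟨0, h0⟩).mono (nhdsWithin_le_iff.2 ?_)
      filter_upwards [Ioo_mem_nhdsLT h0] with η hη
      exact ⟨⟨⟨hη.1.le, hη.2.le.trans hmem.2⟩, hη.2.ne⟩, hη.2⟩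
    have hle : 𝓝[(UI \ {proj S x}) ∩ Iio (proj S x)] (proj S x) ≤
        𝓝[UI \ {proj S x}] (proj S x) := nhdsWithin_mono _ inter_subset_left
    have hlim : Tendsto (fun η => DQ Θ (proj S x) η) (𝓝[UI \ {proj S x}] (proj S x)) (𝓝 0) := by
      rcases hgen with ⟨L, hL⟩ | htop'
      · rwa [tendsto_nhds_unique hzero (hL.mono_left hle)]
      · exact absurd (htop'.mono_left hle) (not_tendsto_atTop_of_tendsto_nhds hzero)
    have hpt : ∀ m, ∃ v ∈ UI, proj S (shift^[ns m - 1] x) < v ∧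
        c * δ ≤ DQ Θ (proj S x) (S.word x (ns m - 1) v) := by
      intro m
      obtain ⟨⟨hne, hblock⟩, hge⟩ := hblocks m
      have hn : ns m - 1 + 1 = ns m := Nat.sub_add_cancel (hpos m)
      obtain ⟨v, hv, hlt, h⟩ := (hbounds (ns m - 1)).2.2 hne (ks m) (by rwa [hn])
      rw [hn] at h
      exact ⟨v, hv, hlt, le_trans (by gcongr) h⟩
    choose v hv hlt hge using hpt
    have hη : Tendsto (fun m => S.word x (ns m - 1) (v m)) atTop
        (𝓝[UI \ {proj S x}] (proj S x)) := by
      refine tendsto_nhdsWithin_iff.2 ⟨?_, Eventually.of_forall fun m =>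
        ⟨S.word_mem _ _ (hv m), ((hmono _ _ (hv m)).1.2 (hlt m)).ne'⟩⟩
      refine tendsto_iff_dist_tendsto_zero.2 (squeeze_zero (fun _ => dist_nonneg) (fun m => ?_)
        ((tendsto_pow_atTop_nhds_zero_of_lt_one hr.le hr1).comp
          ((tendsto_sub_atTop_nat 1).comp hns.tendsto_atTop)))
      rw [Real.dist_eq, S.proj_eq_word x (ns m - 1)]
      exact S.abs_word_sub_le hr.le (fun a ξ hξ => (hb a ξ hξ).2) x _ (hv m) (S.proj_mem _)
    exact absurd (ge_of_tendsto' (hlim.comp hη) hge) (not_le.2 (by positivity))
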